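/- Every optimal rate policy is monotonically increasing: if r* = (r*_1,…,r*_N) is a feasible rate policy that maximizes the throughput ∑_{i=1}^N r_i over all feasible policies, then r*_1 ≤ r*_2 ≤ ⋯ ≤ r*_N. -/

import Mathlib

open Finset

/-- A rate policy `r` is feasible for the single-user energy harvesting channel with
transmitter energies `E`, receiver energies `Ebar`, rate-to-power function `f`,
and decoding cost function `φ`, over slots `1,…,N`. -/
def SUFeasible (N : ℕ) (E Ebar : ℕ → ℝ) (f φ : ℝ → ℝ) (r : ℕ → ℝ) : Prop :=
  (∀ i ∈ Finset.Icc 1 N, 0 ≤ r i) ∧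
  (∀ k ∈ Finset.Icc 1 N,
      ∑ i ∈ Finset.Icc 1 k, f (r i) ≤ ∑ i ∈ Finset.Icc 1 k, E i) ∧
  (∀ k ∈ Finset.Icc 1 N,
      ∑ i ∈ Finset.Icc 1 k, φ (r i) ≤ ∑ i ∈ Finset.Icc 1 k, Ebar i)

theorem aux_eps (f : ℝ → ℝ) (hc : ContinuousOn f (Set.Ici 0)) (hm : StrictMonoOn f (Set.Ici 0))
    (hv : StrictConvexOn ℝ (Set.Ici 0) f) (a b : ℝ) (hb : 0 ≤ b) (hab : b < a) :
    f ((a + b) / 2) ≤ f a ∧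
      ∀ᶠ x in nhds ((a + b) / 2), f ((a + b) / 2) + f x < f a + f b := by
  have hpos : 0 < (a + b) / 2 := by linarith
  refine ⟨(hm (Set.mem_Ici.2 hpos.le) (Set.mem_Ici.2 (by linarith)) (by linarith)).le, ?_⟩
  have h2 := hv.2 (Set.mem_Ici.2 (by linarith : (0:ℝ) ≤ a)) (Set.mem_Ici.2 hb) hab.ne'
    (by norm_num : (0:ℝ) < 1/2) (by norm_num : (0:ℝ) < 1/2) (by norm_num)
  simp only [smul_eq_mul] at h2
  rw [show 1 / 2 * a + 1 / 2 * b = (a + b) / 2 by ring] at h2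
  have hca : ContinuousAt f ((a + b) / 2) := hc.continuousAt (Ici_mem_nhds hpos)
  have := hca.eventually_lt_const (show f ((a + b) / 2) < f a + f b - f ((a + b) / 2) by linarith)
  filter_upwards [this] with x hx
  linarith

theorem aux_sum (g : ℝ → ℝ) (r : ℕ → ℝ) (i j k : ℕ) (hij : i < j) (m x : ℝ) :
    ∑ l ∈ Finset.Icc 1 k, g (if l = i then m else if l = j then x else r l) =
      ∑ l ∈ Finset.Icc 1 k, g (r l) + (if i ∈ Finset.Icc 1 k then g m - g (r i) else 0)
        + (if j ∈ Finset.Icc 1 k then g x - g (r j) else 0) := by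
  rw [← Finset.sum_ite_eq' (Finset.Icc 1 k) i (fun _ => g m - g (r i)),
    ← Finset.sum_ite_eq' (Finset.Icc 1 k) j (fun _ => g x - g (r j)),
    ← Finset.sum_add_distrib, ← Finset.sum_add_distrib]
  refine Finset.sum_congr rfl fun l _ => ?_
  by_cases h1 : l = i
  · subst h1
    simp [hij.ne]
  · by_cases h2 : l = j
    · subst h2
      simp [hij.ne']
    · simp [h1, h2]

theorem aux_feas (g : ℝ → ℝ) (r : ℕ → ℝ) (i j k : ℕ) (hi : 1 ≤ i) (hij : i < j) (m x : ℝ)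
    (h1 : g m ≤ g (r i)) (h2 : g m + g x < g (r i) + g (r j)) :
    ∑ l ∈ Finset.Icc 1 k, g (if l = i then m else if l = j then x else r l) ≤
      ∑ l ∈ Finset.Icc 1 k, g (r l) := by
  rw [aux_sum g r i j k hij m x]
  simp only [Finset.mem_Icc]
  split_ifs with p q q
  · linarith
  · linarith
  · omega
  · linarith

/-- every optimal rate policy is monotonically increasing. -/
theorem optimal_policy_monotone
    (N : ℕ) (hN : 1 ≤ N)
    (E Ebar : ℕ → ℝ)
    (hE : ∀ i ∈ Finset.Icc 1 N, 0 ≤ E i)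
    (hEbar : ∀ i ∈ Finset.Icc 1 N, 0 ≤ Ebar i)
    (f φ : ℝ → ℝ)
    (hf_cont : ContinuousOn f (Set.Ici 0))
    (hf_mono : StrictMonoOn f (Set.Ici 0))
    (hf_conv : StrictConvexOn ℝ (Set.Ici 0) f)
    (hf_nonneg : ∀ x : ℝ, 0 ≤ x → 0 ≤ f x)
    (hf0 : f 0 = 0)
    (hphi_cont : ContinuousOn φ (Set.Ici 0))
    (hphi_mono : StrictMonoOn φ (Set.Ici 0))
    (hphi_conv : StrictConvexOn ℝ (Set.Ici 0) φ)
    (hphi_nonneg : ∀ x : ℝ, 0 ≤ x → 0 ≤ φ x)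
    (hphi0 : φ 0 = 0)
    (r : ℕ → ℝ)
    (hfeas : SUFeasible N E Ebar f φ r)
    (hopt : ∀ r' : ℕ → ℝ, SUFeasible N E Ebar f φ r' →
      ∑ i ∈ Finset.Icc 1 N, r' i ≤ ∑ i ∈ Finset.Icc 1 N, r i) :
    ∀ i j : ℕ, 1 ≤ i → i ≤ j → j ≤ N → r i ≤ r j := by
  intro i j hi hij hj
  by_contra! hlt
  have hij' : i < j := lt_of_le_of_ne hij (by rintro rfl; exact lt_irrefl _ hlt)
  obtain ⟨hr, h1, h2⟩ := hfeas
  have hrj : 0 ≤ r j := hr j (Finset.mem_Icc.2 ⟨by omega, hj⟩)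
  obtain ⟨fa, fe⟩ := aux_eps f hf_cont hf_mono hf_conv (r i) (r j) hrj hlt
  obtain ⟨pa, pe⟩ := aux_eps φ hphi_cont hphi_mono hphi_conv (r i) (r j) hrj hlt
  obtain ⟨δ, hδ, hb⟩ := Metric.eventually_nhds_iff.1 (fe.and pe)
  obtain ⟨m, hm⟩ : ∃ m, m = (r i + r j) / 2 := ⟨_, rfl⟩
  rw [← hm] at fa pa hb
  obtain ⟨hx1, hx2⟩ := hb (y := m + δ / 2) (by
    rw [Real.dist_eq, add_sub_cancel_left, abs_of_pos (by linarith)]; linarith)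
  have key := hopt (fun l => if l = i then m else if l = j then m + δ / 2 else r l) ⟨?_, ?_, ?_⟩
  · have e := aux_sum id r i j N hij' m (m + δ / 2)
    simp only [id] at e
    rw [e, if_pos (Finset.mem_Icc.2 ⟨hi, by omega⟩),
      if_pos (Finset.mem_Icc.2 ⟨by omega, hj⟩)] at key
    linarith
  · intro l hl
    have := hr l hl
    dsimp only
    split_ifs <;> linarith
  · intro k hk
    exact (aux_feas f r i j k hi hij' m _ fa hx1).trans (h1 k hk)
  · intro k hk
    exact (aux_feas φ r i j k hi hij' m _ pa hx2).trans (h2 k hk)
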